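/- Let K ⊆ 𝕊_d be a closed A(𝔹_d)-totally null set and let λ ∈ 𝔹_d. Then for every continuous function f : K ∪ {λ} → ℂ with sup_{z ∈ K ∪ {λ}} |f(z)| < 1, there exists φ ∈ A(𝔹_d) with ‖φ‖_∞ < 1 such that φ(z) = f(z) for every z ∈ K ∪ {λ}. In other words, the restriction of the open unit ball of A(𝔹_d) to K ∪ {λ} coincides with the open unit ball of C(K ∪ {λ}). -/

import Mathlib

open MeasureTheory Metric Set Filter Topology

noncomputable section

abbrev CB (d : ℕ) : Set (EuclideanSpace ℂ (Fin d)) := Metric.closedBall 0 1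

instance (d : ℕ) : CompactSpace (CB d) :=
  isCompact_iff_compactSpace.mp (isCompact_closedBall _ _)

instance (d : ℕ) : MeasurableSpace (EuclideanSpace ℂ (Fin d)) := borel _

instance (d : ℕ) : BorelSpace (EuclideanSpace ℂ (Fin d)) := ⟨rfl⟩

def polyAlg (d : ℕ) : Subalgebra ℂ C(CB d, ℂ) :=
  Algebra.adjoin ℂ
    { f : C(CB d, ℂ) | ∃ i : Fin d,
        f = ⟨fun z => (z : EuclideanSpace ℂ (Fin d)) i,
             (EuclideanSpace.proj (𝕜 := ℂ) i).continuous.comp continuous_subtype_val⟩ }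

def ballAlgSub (d : ℕ) : Subalgebra ℂ C(CB d, ℂ) := (polyAlg d).topologicalClosure

def ballAlg (d : ℕ) : Set C(CB d, ℂ) := ballAlgSub d

def sphereD (d : ℕ) : Set (CB d) := {z | ‖(z : EuclideanSpace ℂ (Fin d))‖ = 1}

def openD (d : ℕ) : Set (CB d) := {z | ‖(z : EuclideanSpace ℂ (Fin d))‖ < 1}

def ZS (d : ℕ) (S : Set C(CB d, ℂ)) : Set (CB d) := {z | ∀ φ ∈ S, φ z = 0}

def IX (d : ℕ) (X : Set (CB d)) : Set C(CB d, ℂ) :=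
  {φ | φ ∈ ballAlg d ∧ ∀ z ∈ X, φ z = 0}

def IsZeroSet (d : ℕ) (X : Set (CB d)) : Prop :=
  ∃ S ⊆ ballAlg d, X = ZS d S

/-- A representing measure for a point of the closed ball: a finite positive regular
Borel measure integrating every function of the ball algebra to its value at the point. -/
def IsRepMeasure (d : ℕ) (lam : CB d) (μ : Measure (CB d)) : Prop :=
  IsFiniteMeasure μ ∧ μ.Regular ∧ ∀ φ ∈ ballAlg d, φ lam = ∫ z, φ z ∂μ

/-- `X̂₀` : `X₀` together with all points of the open ball having a representing measure
supported on `X₀`. -/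
def hatSet (d : ℕ) (X0 : Set (CB d)) : Set (CB d) :=
  X0 ∪ {lam | lam ∈ openD d ∧
    ∃ μ : Measure (CB d), IsRepMeasure d lam μ ∧ μ X0ᶜ = 0}

/-- `z` is an isolated point of the set `A`. -/
def IsIsolatedIn (d : ℕ) (A : Set (CB d)) (z : CB d) : Prop :=
  z ∈ A ∧ ∃ U : Set (CB d), IsOpen U ∧ U ∩ A = {z}

/-- A closed ideal of the ball algebra. -/
structure IsClosedIdeal (d : ℕ) (J : Set C(CB d, ℂ)) : Prop where
  subset : J ⊆ ballAlg d
  closed : IsClosed J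
  zero_mem : (0 : C(CB d, ℂ)) ∈ J
  add_mem : ∀ f ∈ J, ∀ g ∈ J, f + g ∈ J
  smul_mem : ∀ (c : ℂ), ∀ f ∈ J, c • f ∈ J
  mul_mem : ∀ f ∈ ballAlg d, ∀ g ∈ J, f * g ∈ J

/-- An `A(𝔹_d)`-Henkin (finite positive regular Borel) measure on the sphere. -/
def IsHenkin (d : ℕ) (μ : Measure (CB d)) : Prop :=
  IsFiniteMeasure μ ∧ μ.Regular ∧ μ (sphereD d)ᶜ = 0 ∧
    ∀ f : ℕ → C(CB d, ℂ), (∀ n, f n ∈ ballAlg d) → (∃ C : ℝ, ∀ n, ‖f n‖ ≤ C) →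
      (∀ z ∈ openD d, Tendsto (fun n => f n z) atTop (𝓝 0)) →
      Tendsto (fun n => ∫ z, f n z ∂μ) atTop (𝓝 0)

/-- An `A(𝔹_d)`-totally null subset of the sphere. -/
def IsTotallyNull (d : ℕ) (K : Set (CB d)) : Prop :=
  K ⊆ sphereD d ∧ ∀ μ : Measure (CB d), IsHenkin d μ → μ K = 0

/-- A complex regular Borel measure on the sphere, given by its polar decomposition:
total variation `var` (a finite positive regular Borel measure concentrated on the
sphere) and a unimodular density. -/
structure CMeasure (d : ℕ) where
  var : Measure (CB d)
  density : CB d → ℂ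
  finite : IsFiniteMeasure var
  regular : var.Regular
  measurable_density : Measurable density
  norm_density : ∀ z, ‖density z‖ = 1
  onSphere : var (sphereD d)ᶜ = 0

/-- Integral of a continuous function against a complex measure. -/
def cInt (d : ℕ) (μ : CMeasure d) (φ : C(CB d, ℂ)) : ℂ :=
  ∫ z, φ z * μ.density z ∂μ.var

/-- An `A(𝔹_d)`-Henkin complex measure on the sphere. -/
def IsHenkinC (d : ℕ) (μ : CMeasure d) : Prop :=
  ∀ f : ℕ → C(CB d, ℂ), (∀ n, f n ∈ ballAlg d) → (∃ C : ℝ, ∀ n, ‖f n‖ ≤ C) →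
    (∀ z ∈ openD d, Tendsto (fun n => f n z) atTop (𝓝 0)) →
    Tendsto (fun n => cInt d μ (f n)) atTop (𝓝 0)

/-- An `A(𝔹_d)`-totally singular complex measure: its total variation is mutually
singular with that of every Henkin complex measure. -/
def IsTotallySingularC (d : ℕ) (μ : CMeasure d) : Prop :=
  ∀ ν : CMeasure d, IsHenkinC d ν → μ.var ⟂ₘ ν.var

/-- An `A(𝔹_d)`-totally null Borel subset of the sphere (complex-measure version). -/
def IsTotallyNullC (d : ℕ) (K : Set (CB d)) : Prop :=
  K ⊆ sphereD d ∧ ∀ μ : CMeasure d, IsHenkinC d μ → μ.var K = 0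

/-- The entire function on `ℂ^d` defined by a polynomial. -/
def polyEval {d : ℕ} (p : MvPolynomial (Fin d) ℂ) (x : EuclideanSpace ℂ (Fin d)) : ℂ :=
  MvPolynomial.eval x.ofLp p

/-- The derivative of a polynomial at `a` in the direction `b`. -/
def polyDir {d : ℕ} (p : MvPolynomial (Fin d) ℂ) (b a : EuclideanSpace ℂ (Fin d)) : ℂ :=
  ∑ j, b j * polyEval (MvPolynomial.pderiv j p) a

lemma differentiable_polyEval {d : ℕ} (p : MvPolynomial (Fin d) ℂ) :
    Differentiable ℂ (polyEval p) := by
  have h := AnalyticOnNhd.eval_continuousLinearMap' (𝕜 := ℂ)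
    (fun i : Fin d => EuclideanSpace.proj (𝕜 := ℂ) i) p
  exact fun x => (h x (mem_univ x)).differentiableAt

lemma continuous_polyEval {d : ℕ} (p : MvPolynomial (Fin d) ℂ) : Continuous (polyEval p) :=
  (differentiable_polyEval p).continuous

lemma hasDerivAt_polyEval_line {d : ℕ} (p : MvPolynomial (Fin d) ℂ)
    (a b : EuclideanSpace ℂ (Fin d)) (s : ℂ) :
    HasDerivAt (fun s : ℂ => polyEval p (a + s • b)) (polyDir p b (a + s • b)) s := by
  induction p using MvPolynomial.induction_on with
  | C c => simpa [polyEval, polyDir] using hasDerivAt_const s c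
  | add p q hp hq =>
    have hf : (fun s : ℂ => polyEval (p + q) (a + s • b)) =
        (fun s => polyEval p (a + s • b)) + fun s => polyEval q (a + s • b) := by
      ext; simp [polyEval]
    rw [hf]
    refine (hp.add hq).congr_deriv ?_
    simp [polyDir, polyEval, mul_add, Finset.sum_add_distrib]
  | mul_X p i hp =>
    have h2 : HasDerivAt (fun s : ℂ => a i + s * b i) (b i) s := by
      simpa using ((hasDerivAt_id s).mul_const (b i)).const_add (a i)
    have hf : (fun s : ℂ => polyEval (p * MvPolynomial.X i) (a + s • b)) =
        (fun s => polyEval p (a + s • b)) * fun s => a i + s * b i := by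
      ext; simp [polyEval]
    rw [hf]
    refine (hp.mul h2).congr_deriv ?_
    simp only [polyDir, polyEval, Derivation.leibniz, MvPolynomial.pderiv_X, map_add, smul_eq_mul,
      map_mul, MvPolynomial.eval_X, mul_add, Finset.sum_add_distrib, Finset.sum_mul,
      Pi.single_apply, apply_ite, map_zero, mul_one, mul_zero,
      Finset.sum_ite_eq, Finset.mem_univ, if_true, PiLp.add_apply, PiLp.smul_apply]
    rw [add_comm]
    congr 1
    · exact mul_comm _ _
    · rw [← Finset.sum_add_distrib]
      exact Finset.sum_congr rfl fun j _ => by ring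

lemma norm_polyDir_le {d : ℕ} (p : MvPolynomial (Fin d) ℂ) (a b : EuclideanSpace ℂ (Fin d))
    {B τ : ℝ} (hτ : 0 < τ) (h : ∀ s : ℂ, ‖s‖ = τ → ‖polyEval p (a + s • b)‖ ≤ B) :
    ‖polyDir p b a‖ ≤ B / τ := by
  have hd := fun s => hasDerivAt_polyEval_line p a b s
  have := Complex.norm_deriv_le_of_forall_mem_sphere_norm_le (c := 0) hτ
    (Differentiable.diffContOnCl fun s => (hd s).differentiableAt)
    (fun s hs => h s (by simpa using hs))
  rw [(hd 0).deriv] at this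
  simpa using this

lemma exists_polyEval_eq_integral {d : ℕ} (q : MvPolynomial (Fin d) ℂ) :
    ∃ r : MvPolynomial (Fin d) ℂ, ∀ z, polyEval r z =
      ∫ x in (0 : ℝ)..1, (2 * x : ℂ) * polyEval q ((1 - x ^ 2 : ℂ) • z) := by
  have hc : ∀ (q : MvPolynomial (Fin d) ℂ) (z : EuclideanSpace ℂ (Fin d)), IntervalIntegrable
      (fun x : ℝ => (2 * x : ℂ) * polyEval q ((1 - x ^ 2 : ℂ) • z)) volume 0 1 := fun q z =>
    Continuous.intervalIntegrable (by have := continuous_polyEval q; fun_prop) _ _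
  induction q using MvPolynomial.induction_on' with
  | monomial u c =>
    refine ⟨MvPolynomial.C (∫ x in (0 : ℝ)..1, (2 * x : ℂ) * ∏ i, (1 - x ^ 2 : ℂ) ^ u i) *
      MvPolynomial.monomial u c, fun z => ?_⟩
    simp only [polyEval, map_mul, MvPolynomial.eval_C]
    rw [← intervalIntegral.integral_mul_const]
    congr 1 with x
    simp [MvPolynomial.eval_monomial, Finsupp.prod_fintype, mul_pow, Finset.prod_mul_distrib]
    ring
  | add p q hp hq =>
    obtain ⟨r, hr⟩ := hp
    obtain ⟨r', hr'⟩ := hq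
    refine ⟨r + r', fun z => ?_⟩
    have : polyEval (r + r') z = polyEval r z + polyEval r' z := by simp [polyEval]
    rw [this, hr, hr', ← intervalIntegral.integral_add (hc _ _) (hc _ _)]
    simp [polyEval, mul_add]

lemma norm_add_smul_sq {d : ℕ} {z w : EuclideanSpace ℂ (Fin d)} (h : inner ℂ z w = 0) (a s : ℂ) :
    ‖a • z + s • w‖ ^ 2 = ‖a‖ ^ 2 * ‖z‖ ^ 2 + ‖s‖ ^ 2 * ‖w‖ ^ 2 := by
  have : inner ℂ (a • z) (s • w) = 0 := by
    rw [inner_smul_left, inner_smul_right, h]; simp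
  rw [norm_add_sq (𝕜 := ℂ), this, norm_smul, norm_smul]
  simp [mul_pow]

/-- On the sphere, `conj z_i * p` is uniformly close to an explicit polynomial, with an error
controlled by the size of `p` on a smaller ball. -/
lemma norm_conj_mul_polyEval_sub_le {d : ℕ} (p : MvPolynomial (Fin d) ℂ) (i : Fin d)
    {z : EuclideanSpace ℂ (Fin d)} (hz : ‖z‖ = 1) {B δ η : ℝ} (hη : 0 < η) (hη1 : η ≤ 1)
    (hB : ∀ x : EuclideanSpace ℂ (Fin d), ‖x‖ ≤ 1 → ‖polyEval p x‖ ≤ B)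
    (hδ : ∀ x : EuclideanSpace ℂ (Fin d), ‖x‖ ≤ 1 - η ^ 2 / 2 → ‖polyEval p x‖ ≤ δ) :
    ‖(starRingEnd ℂ) (z i) * polyEval p z - ∫ x in (0 : ℝ)..1,
      (2 * x : ℂ) * polyEval (MvPolynomial.pderiv i p) ((1 - x ^ 2 : ℂ) • z)‖
      ≤ δ + 2 * B * η + 4 * δ / η ^ 2 := by
  set c := (starRingEnd ℂ) (z i) with hc
  set w : EuclideanSpace ℂ (Fin d) := EuclideanSpace.single i 1 - c • z with hw
  have hzi : ‖c‖ ≤ 1 := by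
    rw [hc, RCLike.norm_conj, ← hz]; exact PiLp.norm_apply_le z i
  have horth : inner ℂ z w = 0 := by
    rw [hw, inner_sub_right, inner_smul_right, inner_self_eq_norm_sq_to_K, hz]
    simp [hc, EuclideanSpace.inner_single_right]
  have hwn : ‖w‖ ≤ 1 := by
    have h1 := norm_add_smul_sq horth c 1
    have h2 : c • z + (1 : ℂ) • w = EuclideanSpace.single i 1 := by simp [hw]
    rw [h2] at h1
    simp [hz] at h1
    nlinarith [norm_nonneg w, sq_nonneg ‖c‖]
  have hcont : ∀ q : MvPolynomial (Fin d) ℂ,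
      Continuous fun x : ℝ => (2 * x : ℂ) * polyEval q ((1 - x ^ 2 : ℂ) • z) := fun q => by
    have := continuous_polyEval q; fun_prop
  have hdircont : ∀ b : EuclideanSpace ℂ (Fin d),
      Continuous fun x : ℝ => (2 * x : ℂ) * polyDir p b ((1 - x ^ 2 : ℂ) • z) := fun b => by
    unfold polyDir
    have := fun j => continuous_polyEval (MvPolynomial.pderiv j p); fun_prop
  have hsplit : ∀ a, polyEval (MvPolynomial.pderiv i p) a = c * polyDir p z a + polyDir p w a := by
    intro a
    simp only [polyDir, Finset.mul_sum, ← Finset.sum_add_distrib, hw]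
    rw [Finset.sum_eq_single i]
    · simp; ring
    · intro j _ hj; simp [hj]; ring
    · simp
  have hFTC : ∫ x in (0 : ℝ)..1, (2 * x : ℂ) * polyDir p z ((1 - x ^ 2 : ℂ) • z)
      = polyEval p z - polyEval p 0 := by
    have hder : ∀ x : ℝ, HasDerivAt (fun x : ℝ => - polyEval p ((1 - x ^ 2 : ℂ) • z))
        ((2 * x : ℂ) * polyDir p z ((1 - x ^ 2 : ℂ) • z)) x := by
      intro x
      have h1 := hasDerivAt_polyEval_line p 0 z (1 - (x : ℂ) ^ 2)
      have h2 : HasDerivAt (fun x : ℝ => (1 - (x : ℂ) ^ 2 : ℂ)) (-(2 * x) : ℂ) x := by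
        have := ((Complex.ofRealCLM.hasDerivAt (x := x)).pow 2).const_sub 1
        simpa using this
      have h3 := (HasDerivAt.comp x h1 h2).neg
      simp only [zero_add] at h3
      exact h3.congr_deriv (by ring)
    rw [intervalIntegral.integral_eq_sub_of_hasDerivAt (fun x _ => hder x)
      ((hdircont z).intervalIntegrable _ _)]
    simp; ring
  have hint : ∫ x in (0 : ℝ)..1,
      (2 * x : ℂ) * polyEval (MvPolynomial.pderiv i p) ((1 - x ^ 2 : ℂ) • z)
      = c * (polyEval p z - polyEval p 0)
        + ∫ x in (0 : ℝ)..1, (2 * x : ℂ) * polyDir p w ((1 - x ^ 2 : ℂ) • z) := by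
    rw [← hFTC, ← intervalIntegral.integral_const_mul, ← intervalIntegral.integral_add
      (((hdircont z).const_mul c).intervalIntegrable _ _) ((hdircont w).intervalIntegrable _ _)]
    congr 1 with x
    rw [hsplit]; ring
  have hnear : ‖∫ x in (0 : ℝ)..η, (2 * x : ℂ) * polyDir p w ((1 - x ^ 2 : ℂ) • z)‖
      ≤ 2 * B * η := by
    have := intervalIntegral.norm_integral_le_of_norm_le_const (a := 0) (b := η) (C := 2 * B)
      (f := fun x : ℝ => (2 * x : ℂ) * polyDir p w ((1 - x ^ 2 : ℂ) • z)) ?_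
    · simpa [abs_of_pos hη] using this
    intro x hx
    rw [uIoc_of_le hη.le] at hx
    have hx0 : 0 < x := hx.1
    have hx1 : x ≤ 1 := hx.2.trans hη1
    have h1 : ‖polyDir p w ((1 - x ^ 2 : ℂ) • z)‖ ≤ B / x := by
      refine norm_polyDir_le p _ w hx0 fun s hs => hB _ ?_
      have h2 := norm_add_smul_sq horth (1 - x ^ 2 : ℂ) s
      have h3 : ‖(1 - x ^ 2 : ℂ)‖ = 1 - x ^ 2 := by
        rw [← Complex.ofReal_pow, ← Complex.ofReal_one, ← Complex.ofReal_sub, Complex.norm_real,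
          Real.norm_of_nonneg (by nlinarith)]
      rw [h3, hs, hz] at h2
      refine abs_le_one_iff_mul_self_le_one.mpr ?_ |> le_of_abs_le
      have : x ^ 2 * ‖w‖ ^ 2 ≤ x ^ 2 * 1 := by
        gcongr; nlinarith [norm_nonneg w]
      have : x ^ 2 * x ^ 2 ≤ x ^ 2 * 1 := by gcongr; nlinarith
      nlinarith
    rw [norm_mul]
    have h4 : ‖(2 * x : ℂ)‖ = 2 * x := by simp [abs_of_pos hx0]
    rw [h4]
    calc 2 * x * _ ≤ 2 * x * (B / x) := by gcongr
      _ = 2 * B := by field_simp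
  have hfar : ‖∫ x in η..1, (2 * x : ℂ) * polyDir p w ((1 - x ^ 2 : ℂ) • z)‖
      ≤ 4 * δ / η ^ 2 := by
    have hδ0 : 0 ≤ δ := (norm_nonneg _).trans (hδ 0 (by simp; nlinarith))
    have := intervalIntegral.norm_integral_le_of_norm_le_const (a := η) (b := 1)
      (C := 4 * δ / η ^ 2)
      (f := fun x : ℝ => (2 * x : ℂ) * polyDir p w ((1 - x ^ 2 : ℂ) • z)) ?_
    · refine this.trans ?_
      rw [abs_of_nonneg (by linarith)]
      exact mul_le_of_le_one_right (by positivity) (by linarith)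
    intro x hx
    rw [uIoc_of_le hη1] at hx
    have hx0 : 0 < x := hη.trans hx.1
    have h1 : ‖polyDir p w ((1 - x ^ 2 : ℂ) • z)‖ ≤ δ / (η ^ 2 / 2) := by
      refine norm_polyDir_le p _ w (by positivity) fun s hs => hδ _ ?_
      have h3 : ‖(1 - x ^ 2 : ℂ)‖ = 1 - x ^ 2 := by
        rw [← Complex.ofReal_pow, ← Complex.ofReal_one, ← Complex.ofReal_sub, Complex.norm_real,
          Real.norm_of_nonneg (by nlinarith [hx.2])]
      have h4 : ‖s • w‖ ≤ η ^ 2 / 2 := by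
        rw [norm_smul, hs]; exact mul_le_of_le_one_right (by positivity) hwn
      have h5 := norm_add_le ((1 - x ^ 2 : ℂ) • z) (s • w)
      rw [norm_smul, h3, hz] at h5
      nlinarith [hx.1]
    rw [norm_mul]
    have h4 : ‖(2 * x : ℂ)‖ ≤ 2 := by simp [abs_of_pos hx0]; linarith [hx.2]
    calc _ ≤ 2 * (δ / (η ^ 2 / 2)) := by gcongr
      _ = 4 * δ / η ^ 2 := by field_simp; ring
  rw [hint, ← intervalIntegral.integral_add_adjacent_intervals
    ((hdircont w).intervalIntegrable 0 η) ((hdircont w).intervalIntegrable η 1)]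
  set I := ∫ x in (0 : ℝ)..η, (2 * x : ℂ) * polyDir p w ((1 - x ^ 2 : ℂ) • z)
  set J := ∫ x in η..1, (2 * x : ℂ) * polyDir p w ((1 - x ^ 2 : ℂ) • z)
  have h0 : ‖polyEval p 0‖ ≤ δ := hδ 0 (by simp; nlinarith)
  calc _ = ‖c * polyEval p 0 - (I + J)‖ := by congr 1; ring
    _ ≤ ‖c * polyEval p 0‖ + (‖I‖ + ‖J‖) := (norm_sub_le _ _).trans (by gcongr; exact norm_add_le _ _)
    _ ≤ 1 * δ + (2 * B * η + 4 * δ / η ^ 2) := by rw [norm_mul]; gcongr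
    _ = _ := by ring

/-- The restriction of a polynomial to the closed ball. -/
def polyMap {d : ℕ} (p : MvPolynomial (Fin d) ℂ) : C(CB d, ℂ) :=
  ⟨fun z => polyEval p z, (continuous_polyEval p).comp continuous_subtype_val⟩

@[simp] lemma polyMap_apply {d : ℕ} (p : MvPolynomial (Fin d) ℂ) (z : CB d) :
    polyMap p z = polyEval p z := rfl

lemma mem_polyAlg_iff {d : ℕ} {φ : C(CB d, ℂ)} : φ ∈ polyAlg d ↔ ∃ p, polyMap p = φ := by
  set f : Fin d → C(CB d, ℂ) := fun i => ⟨fun z => (z : EuclideanSpace ℂ (Fin d)) i,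
    (EuclideanSpace.proj (𝕜 := ℂ) i).continuous.comp continuous_subtype_val⟩ with hf
  have h1 : polyAlg d = (MvPolynomial.aeval (R := ℂ) f).range := by
    rw [← Algebra.adjoin_range_eq_range_aeval, polyAlg]
    congr 1
    ext g
    simp [hf, eq_comm]
  have h2 : ∀ p, MvPolynomial.aeval (R := ℂ) f p = polyMap p := by
    intro p
    induction p using MvPolynomial.induction_on with
    | C c => ext z; simp [polyEval]
    | add p q hp hq => rw [map_add, hp, hq]; ext z; simp [polyEval]
    | mul_X p i hp =>
      rw [map_mul, hp]
      ext z
      simp only [MvPolynomial.aeval_X, ContinuousMap.mul_apply, polyMap_apply, polyEval, map_mul,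
        MvPolynomial.eval_X]
      rfl
  simp [h1, AlgHom.mem_range, h2]

lemma polyMap_mem_ballAlg {d : ℕ} (p : MvPolynomial (Fin d) ℂ) : polyMap p ∈ ballAlg d :=
  (polyAlg d).le_topologicalClosure (mem_polyAlg_iff.mpr ⟨p, rfl⟩)

lemma exists_polyMap_norm_sub_lt {d : ℕ} {φ : C(CB d, ℂ)} (hφ : φ ∈ ballAlg d) {ε : ℝ}
    (hε : 0 < ε) : ∃ p, ‖φ - polyMap p‖ < ε := by
  have h : φ ∈ closure (polyAlg d : Set C(CB d, ℂ)) := hφ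
  obtain ⟨ψ, hψ, hd⟩ := Metric.mem_closure_iff.mp h ε hε
  obtain ⟨p, rfl⟩ := mem_polyAlg_iff.mp hψ
  exact ⟨p, by rwa [← dist_eq_norm]⟩

lemma isClosed_ballAlg (d : ℕ) : IsClosed (ballAlg d) :=
  (polyAlg d).isClosed_topologicalClosure

lemma norm_le_of_sphere {d : ℕ} (hd : 1 ≤ d) {g : EuclideanSpace ℂ (Fin d) → ℂ}
    (hg : Differentiable ℂ g) {C : ℝ} (h : ∀ z, ‖z‖ = 1 → ‖g z‖ ≤ C)
    {z : EuclideanSpace ℂ (Fin d)} (hz : ‖z‖ ≤ 1) : ‖g z‖ ≤ C := by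
  have : Nonempty (Fin d) := ⟨⟨0, hd⟩⟩
  refine Complex.norm_le_of_forall_mem_frontier_norm_le (U := ball 0 1) isBounded_ball
    hg.diffContOnCl (fun x hx => h x ?_) ?_
  · rw [frontier_ball _ one_ne_zero] at hx; simpa using hx
  · rw [closure_ball _ one_ne_zero]; simpa using hz

/-- The maximum modulus principle for the ball algebra. -/
lemma norm_le_of_mem_ballAlg {d : ℕ} (hd : 1 ≤ d) {φ : C(CB d, ℂ)} (hφ : φ ∈ ballAlg d) {C : ℝ}
    (h : ∀ z ∈ sphereD d, ‖φ z‖ ≤ C) : ‖φ‖ ≤ C := by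
  have key : ∀ z : CB d, ‖φ z‖ ≤ C := by
    intro z
    refine le_of_forall_pos_le_add fun ε hε => ?_
    obtain ⟨p, hp⟩ := exists_polyMap_norm_sub_lt hφ (half_pos hε)
    have hp' : ∀ x : CB d, ‖φ x - polyEval p x‖ ≤ ε / 2 := fun x =>
      ((φ - polyMap p).norm_coe_le_norm x).trans hp.le
    have h1 : ‖polyEval p z‖ ≤ C + ε / 2 := by
      refine norm_le_of_sphere hd (differentiable_polyEval p) (fun x hx => ?_)
        (mem_closedBall_zero_iff.mp z.2)
      have hx1 := hp' ⟨x, by simp [hx]⟩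
      have hx2 := h ⟨x, by simp [hx]⟩ hx
      have hx3 := norm_sub_norm_le (polyEval p x) (φ ⟨x, by simp [hx]⟩)
      rw [norm_sub_rev] at hx3
      linarith
    have := norm_sub_norm_le (φ z) (polyEval p z)
    linarith [hp' z]
  refine (ContinuousMap.norm_le _ ((norm_nonneg _).trans (key ⟨0, by simp⟩))).mpr key

/-- The minimum principle for the real part of a polynomial. -/
lemma re_polyEval_nonneg {d : ℕ} (hd : 1 ≤ d) {p : MvPolynomial (Fin d) ℂ}
    (h : ∀ z, ‖z‖ = 1 → 0 ≤ (polyEval p z).re) {z : EuclideanSpace ℂ (Fin d)} (hz : ‖z‖ ≤ 1) :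
    0 ≤ (polyEval p z).re := by
  have := norm_le_of_sphere hd (g := fun x => Complex.exp (-polyEval p x)) (C := 1)
    (differentiable_polyEval p).neg.cexp (fun x hx => by simpa [Complex.norm_exp] using h x hx) hz
  simpa [Complex.norm_exp] using this

/-- A bounded sequence in the ball algebra tending to zero uniformly on smaller balls. -/
def Vanishing {d : ℕ} (f : ℕ → C(CB d, ℂ)) : Prop :=
  (∀ n, f n ∈ ballAlg d) ∧ (∃ C : ℝ, ∀ n, ‖f n‖ ≤ C) ∧
    ∀ r < (1 : ℝ), ∀ ε > 0, ∀ᶠ n in atTop, ∀ z : CB d,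
      ‖(z : EuclideanSpace ℂ (Fin d))‖ ≤ r → ‖f n z‖ ≤ ε

/-- Multiplication by `q` preserves vanishing sequences up to uniformly small errors
on the sphere. -/
def IsVanishingMultiplier {d : ℕ} (q : C(CB d, ℂ)) : Prop :=
  ∀ f, Vanishing f → ∃ g, Vanishing g ∧
    ∀ ε > 0, ∀ᶠ n in atTop, ∀ z ∈ sphereD d, ‖q z * f n z - g n z‖ ≤ ε

lemma Vanishing.add {d : ℕ} {f g : ℕ → C(CB d, ℂ)} (hf : Vanishing f) (hg : Vanishing g) :
    Vanishing fun n => f n + g n := by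
  obtain ⟨hf1, ⟨C, hf2⟩, hf3⟩ := hf
  obtain ⟨hg1, ⟨D, hg2⟩, hg3⟩ := hg
  refine ⟨fun n => (ballAlgSub d).add_mem (hf1 n) (hg1 n),
    ⟨C + D, fun n => (norm_add_le _ _).trans (add_le_add (hf2 n) (hg2 n))⟩, fun r hr ε hε => ?_⟩
  filter_upwards [hf3 r hr _ (half_pos hε), hg3 r hr _ (half_pos hε)] with n h1 h2 z hz
  calc ‖f n z + g n z‖ ≤ _ := norm_add_le _ _
    _ ≤ ε / 2 + ε / 2 := add_le_add (h1 z hz) (h2 z hz)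
    _ = ε := by ring

lemma Vanishing.mul_left {d : ℕ} {f : ℕ → C(CB d, ℂ)} (hf : Vanishing f) {q : C(CB d, ℂ)}
    (hq : q ∈ ballAlg d) : Vanishing fun n => q * f n := by
  obtain ⟨hf1, ⟨C, hf2⟩, hf3⟩ := hf
  refine ⟨fun n => (ballAlgSub d).mul_mem hq (hf1 n),
    ⟨‖q‖ * C, fun n => (norm_mul_le _ _).trans (by gcongr; exact hf2 n)⟩, fun r hr ε hε => ?_⟩
  have hpos : 0 < ‖q‖ + 1 := by positivity
  filter_upwards [hf3 r hr (ε / (‖q‖ + 1)) (by positivity)] with n h1 z hz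
  calc ‖q z * f n z‖ = ‖q z‖ * ‖f n z‖ := norm_mul _ _
    _ ≤ (‖q‖ + 1) * (ε / (‖q‖ + 1)) := by
      gcongr
      · exact (q.norm_coe_le_norm z).trans (by linarith)
      · exact h1 z hz
    _ = ε := by field_simp

lemma isVanishingMultiplier_of_mem {d : ℕ} {q : C(CB d, ℂ)} (hq : q ∈ ballAlg d) :
    IsVanishingMultiplier q := fun f hf =>
  ⟨_, hf.mul_left hq, fun ε hε => Eventually.of_forall fun n z _ => by simpa using hε.le⟩

lemma IsVanishingMultiplier.add {d : ℕ} {p q : C(CB d, ℂ)} (hp : IsVanishingMultiplier p)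
    (hq : IsVanishingMultiplier q) : IsVanishingMultiplier (p + q) := by
  intro f hf
  obtain ⟨g, hg, hg'⟩ := hp f hf
  obtain ⟨h, hh, hh'⟩ := hq f hf
  refine ⟨_, hg.add hh, fun ε hε => ?_⟩
  filter_upwards [hg' _ (half_pos hε), hh' _ (half_pos hε)] with n h1 h2 z hz
  calc ‖(p z + q z) * f n z - (g n z + h n z)‖
      = ‖(p z * f n z - g n z) + (q z * f n z - h n z)‖ := by congr 1; ring
    _ ≤ _ := norm_add_le _ _
    _ ≤ ε / 2 + ε / 2 := add_le_add (h1 z hz) (h2 z hz)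
    _ = ε := by ring

lemma IsVanishingMultiplier.mul {d : ℕ} {p q : C(CB d, ℂ)} (hp : IsVanishingMultiplier p)
    (hq : IsVanishingMultiplier q) : IsVanishingMultiplier (p * q) := by
  intro f hf
  obtain ⟨g, hg, hg'⟩ := hq f hf
  obtain ⟨h, hh, hh'⟩ := hp g hg
  refine ⟨h, hh, fun ε hε => ?_⟩
  have hpos : 0 < ‖p‖ + 1 := by positivity
  filter_upwards [hg' (ε / 2 / (‖p‖ + 1)) (by positivity), hh' _ (half_pos hε)] with n h1 h2 z hz
  calc ‖(p z * q z) * f n z - h n z‖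
      = ‖p z * (q z * f n z - g n z) + (p z * g n z - h n z)‖ := by congr 1; ring
    _ ≤ ‖p z‖ * ‖q z * f n z - g n z‖ + ‖p z * g n z - h n z‖ := by
      rw [← norm_mul]; exact norm_add_le _ _
    _ ≤ (‖p‖ + 1) * (ε / 2 / (‖p‖ + 1)) + ε / 2 := by
      gcongr
      · exact (p.norm_coe_le_norm z).trans (by linarith)
      · exact h1 z hz
      · exact h2 z hz
    _ = ε := by field_simp; ring

lemma vanishing_of_sub {d : ℕ} {f g : ℕ → C(CB d, ℂ)} (hf : Vanishing f)
    (hg : ∀ n, g n ∈ ballAlg d) (h : ∀ n : ℕ, ‖f n - g n‖ ≤ 1 / (n + 1)) : Vanishing g := by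
  obtain ⟨hf1, ⟨C, hf2⟩, hf3⟩ := hf
  refine ⟨hg, ⟨C + 1, fun n => ?_⟩, fun r hr ε hε => ?_⟩
  · have h1 := norm_sub_norm_le (g n) (f n)
    rw [norm_sub_rev] at h1
    have h2 : 1 / ((n : ℝ) + 1) ≤ 1 := by
      rw [div_le_one (by positivity)]; linarith [n.cast_nonneg (α := ℝ)]
    linarith [h n, hf2 n]
  · have h0 := tendsto_one_div_add_atTop_nhds_zero_nat (𝕜 := ℝ)
    filter_upwards [hf3 r hr _ (half_pos hε), h0.eventually_le_const (half_pos hε)] with n h1 h2 z hz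
    have h3 := (f n - g n).norm_coe_le_norm z
    have h4 := norm_sub_norm_le (g n z) (f n z)
    rw [norm_sub_rev] at h4
    simp only [ContinuousMap.sub_apply] at h3
    linarith [h n, h1 z hz]

/-- The complex conjugate of a coordinate function. -/
def conjCoord {d : ℕ} (i : Fin d) : C(CB d, ℂ) :=
  star ⟨fun z => (z : EuclideanSpace ℂ (Fin d)) i,
    (EuclideanSpace.proj (𝕜 := ℂ) i).continuous.comp continuous_subtype_val⟩

lemma conjCoord_apply {d : ℕ} (i : Fin d) (z : CB d) :
    conjCoord i z = (starRingEnd ℂ) ((z : EuclideanSpace ℂ (Fin d)) i) := rfl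

lemma norm_conjCoord_apply_le {d : ℕ} (i : Fin d) (z : CB d) : ‖conjCoord i z‖ ≤ 1 := by
  rw [conjCoord_apply, RCLike.norm_conj]
  exact (PiLp.norm_apply_le _ i).trans (mem_closedBall_zero_iff.mp z.2)

lemma norm_integral_pderiv_le {d : ℕ} (p : MvPolynomial (Fin d) ℂ) (i : Fin d)
    {z : EuclideanSpace ℂ (Fin d)} {r τ δ : ℝ} (hz : ‖z‖ ≤ r) (hτ : 0 < τ)
    (hδ : ∀ x : EuclideanSpace ℂ (Fin d), ‖x‖ ≤ r + τ → ‖polyEval p x‖ ≤ δ) :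
    ‖∫ x in (0 : ℝ)..1, (2 * x : ℂ) * polyEval (MvPolynomial.pderiv i p) ((1 - x ^ 2 : ℂ) • z)‖
      ≤ 2 * (δ / τ) := by
  have := intervalIntegral.norm_integral_le_of_norm_le_const (a := 0) (b := 1) (C := 2 * (δ / τ))
    (f := fun x : ℝ => (2 * x : ℂ) *
      polyEval (MvPolynomial.pderiv i p) ((1 - x ^ 2 : ℂ) • z)) ?_
  · simpa using this
  intro x hx
  rw [uIoc_of_le zero_le_one] at hx
  have h3 : ‖(1 - x ^ 2 : ℂ)‖ ≤ 1 := by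
    rw [← Complex.ofReal_pow, ← Complex.ofReal_one, ← Complex.ofReal_sub, Complex.norm_real,
      Real.norm_of_nonneg (by nlinarith [hx.1, hx.2])]
    nlinarith [hx.1]
  have h1 := norm_polyDir_le p ((1 - x ^ 2 : ℂ) • z) (EuclideanSpace.single i 1) hτ
    (B := δ) fun s hs => hδ _ <| by
      refine (norm_add_le _ _).trans ?_
      rw [norm_smul, norm_smul, hs]
      have : ‖(1 - x ^ 2 : ℂ)‖ * ‖z‖ ≤ 1 * ‖z‖ := by gcongr
      simp only [PiLp.norm_single, norm_one, mul_one]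
      linarith
  have h2 : polyDir p (EuclideanSpace.single i 1) ((1 - x ^ 2 : ℂ) • z) =
      polyEval (MvPolynomial.pderiv i p) ((1 - x ^ 2 : ℂ) • z) := by
    rw [polyDir, Finset.sum_eq_single i]
    · simp
    · intro j _ hj; simp [hj]
    · simp
  rw [h2] at h1
  have h4 : ‖(2 * x : ℂ)‖ ≤ 2 := by simp [abs_of_pos hx.1]; linarith [hx.2]
  rw [norm_mul]
  gcongr

lemma isVanishingMultiplier_conjCoord {d : ℕ} (hd : 1 ≤ d) (i : Fin d) :
    IsVanishingMultiplier (conjCoord i) := by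
  intro f hf
  choose p hp using fun n : ℕ =>
    exists_polyMap_norm_sub_lt (hf.1 n) (Nat.one_div_pos_of_nat (α := ℝ) (n := n))
  have hv : Vanishing fun n => polyMap (p n) :=
    vanishing_of_sub hf (fun n => polyMap_mem_ballAlg _) fun n => (hp n).le
  choose r hr using fun n => exists_polyEval_eq_integral (MvPolynomial.pderiv i (p n))
  obtain ⟨-, ⟨B, hB⟩, hsmall⟩ := hv
  have hB0 : 0 ≤ B := (norm_nonneg _).trans (hB 0)
  have hB' : ∀ n, ∀ x : EuclideanSpace ℂ (Fin d), ‖x‖ ≤ 1 → ‖polyEval (p n) x‖ ≤ B :=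
    fun n x hx => ((polyMap (p n)).norm_coe_le_norm ⟨x, by simpa using hx⟩).trans (hB n)
  have hsmall' : ∀ ρ < (1 : ℝ), ∀ ε > 0, ∀ᶠ n in atTop, ∀ x : EuclideanSpace ℂ (Fin d),
      ‖x‖ ≤ ρ → ‖polyEval (p n) x‖ ≤ ε := fun ρ hρ ε hε => by
    filter_upwards [hsmall ρ hρ ε hε] with n hn x hx
    exact hn ⟨x, by simpa using hx.trans hρ.le⟩ hx
  refine ⟨fun n => polyMap (r n), ⟨fun n => polyMap_mem_ballAlg _, ⟨8 * B, fun n => ?_⟩,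
    fun ρ hρ ε hε => ?_⟩, fun ε hε => ?_⟩
  · refine norm_le_of_mem_ballAlg hd (polyMap_mem_ballAlg _) fun z hz => ?_
    have h1 := norm_conj_mul_polyEval_sub_le (p n) i hz one_pos le_rfl (hB' n)
      (fun x hx => hB' n x (hx.trans (by norm_num)))
    rw [← hr n, ← conjCoord_apply] at h1
    have h2 : ‖conjCoord i z * polyEval (p n) z‖ ≤ 1 * B := by
      rw [norm_mul]
      gcongr
      · exact norm_conjCoord_apply_le i z
      · exact hB' n z (mem_closedBall_zero_iff.mp z.2)
    have h3 := norm_sub_norm_le (polyEval (r n) z) (conjCoord i z * polyEval (p n) z)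
    rw [norm_sub_rev] at h3
    rw [polyMap_apply]
    linarith
  · set τ := (1 - ρ) / 2 with hτ
    have hτ0 : 0 < τ := by rw [hτ]; linarith
    filter_upwards [hsmall' (ρ + τ) (by rw [hτ]; linarith) (ε * τ / 2) (by positivity)]
      with n hn z hz
    rw [polyMap_apply, hr]
    refine (norm_integral_pderiv_le (p n) i hz hτ0 hn).trans (le_of_eq ?_)
    field_simp
  · set η := min 1 (ε / (8 * (B + 1))) with hηdef
    have hη : 0 < η := by positivity
    have hη1 : η ≤ 1 := min_le_left _ _
    have hηB : 2 * B * η ≤ ε / 4 := by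
      calc 2 * B * η ≤ 2 * (B + 1) * (ε / (8 * (B + 1))) := by
            gcongr
            · linarith
            · exact min_le_right _ _
        _ = ε / 4 := by field_simp; norm_num
    set δ := ε / 4 / (1 + 4 / η ^ 2) with hδdef
    have hδ : 0 < δ := by positivity
    have hδε : δ + 4 * δ / η ^ 2 = ε / 4 := by rw [hδdef]; field_simp
    have h0 := tendsto_one_div_add_atTop_nhds_zero_nat (𝕜 := ℝ)
    filter_upwards [hsmall' (1 - η ^ 2 / 2) (by nlinarith) δ hδ,
      h0.eventually_le_const (half_pos hε)] with n hn hn' z hz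
    have h1 := norm_conj_mul_polyEval_sub_le (p n) i hz hη hη1 (hB' n) hn
    rw [← hr n, ← conjCoord_apply] at h1
    have h2 : ‖conjCoord i z * (f n z - polyEval (p n) z)‖ ≤ 1 * (ε / 2) := by
      rw [norm_mul]
      gcongr
      · exact norm_conjCoord_apply_le i z
      · exact ((f n - polyMap (p n)).norm_coe_le_norm z).trans ((hp n).le.trans hn')
    calc ‖conjCoord i z * f n z - polyMap (r n) z‖
        = ‖conjCoord i z * (f n z - polyEval (p n) z) +
          (conjCoord i z * polyEval (p n) z - polyEval (r n) z)‖ := by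
          rw [polyMap_apply]; congr 1; ring
      _ ≤ _ := norm_add_le _ _
      _ ≤ ε := by linarith

/-- The multipliers which, together with their conjugates, preserve vanishing sequences. -/
def multiplierStarAlg (d : ℕ) : StarSubalgebra ℂ C(CB d, ℂ) where
  carrier := {q | IsVanishingMultiplier q ∧ IsVanishingMultiplier (star q)}
  mul_mem' hp hq := ⟨hp.1.mul hq.1, by rw [star_mul]; exact hq.2.mul hp.2⟩
  add_mem' hp hq := ⟨hp.1.add hq.1, by rw [star_add]; exact hp.2.add hq.2⟩
  algebraMap_mem' c := by
    refine ⟨isVanishingMultiplier_of_mem ((ballAlgSub d).algebraMap_mem c), ?_⟩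
    rw [← algebraMap_star_comm]
    exact isVanishingMultiplier_of_mem ((ballAlgSub d).algebraMap_mem _)
  star_mem' hp := ⟨hp.2, by rw [star_star]; exact hp.1⟩

/-- Vanishing multipliers are dense in the continuous functions. -/
lemma exists_isVanishingMultiplier_norm_sub_lt {d : ℕ} (hd : 1 ≤ d) (h : C(CB d, ℂ)) {ε : ℝ}
    (hε : 0 < ε) : ∃ q, IsVanishingMultiplier q ∧ ‖h - q‖ < ε := by
  have htop := ContinuousMap.starSubalgebra_topologicalClosure_eq_top_of_separatesPoints
    (multiplierStarAlg d) (by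
      intro x y hxy
      obtain ⟨i, hi⟩ : ∃ i, (x : EuclideanSpace ℂ (Fin d)) i ≠ (y : EuclideanSpace ℂ (Fin d)) i := by
        by_contra! hcon
        exact hxy (Subtype.ext (PiLp.ext hcon))
      refine ⟨conjCoord i, ⟨conjCoord i, ⟨isVanishingMultiplier_conjCoord hd i, ?_⟩, rfl⟩, ?_⟩
      · rw [conjCoord, star_star]
        exact isVanishingMultiplier_of_mem ((polyAlg d).le_topologicalClosure
          (Algebra.subset_adjoin ⟨i, rfl⟩))
      · exact fun hc => hi ((starRingEnd ℂ).injective hc))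
  have hmem : h ∈ closure (multiplierStarAlg d : Set C(CB d, ℂ)) := by
    have : h ∈ (multiplierStarAlg d).topologicalClosure := by rw [htop]; trivial
    exact this
  obtain ⟨q, hq, hd⟩ := Metric.mem_closure_iff.mp hmem ε hε
  exact ⟨q, hq.1, by rwa [← dist_eq_norm]⟩

/-- The real part of a polynomial on the closed ball. -/
def rePolyMap {d : ℕ} (p : MvPolynomial (Fin d) ℂ) : C(CB d, ℝ) :=
  ⟨fun z => (polyEval p z).re,
    Complex.continuous_re.comp ((continuous_polyEval p).comp continuous_subtype_val)⟩

@[simp] lemma rePolyMap_apply {d : ℕ} (p : MvPolynomial (Fin d) ℂ) (z : CB d) :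
    rePolyMap p z = (polyEval p z).re := rfl

/-- The cone of functions dominating, on the sphere, a function of the form
`u - c ε + Re p - Re p(0)` with `u ≥ 0`, `c ≥ 0` and `u ≥ c M` on `K`. -/
def dominatingCone {d : ℕ} (K : Set (CB d)) (M ε : ℝ) : PointedCone ℝ C(CB d, ℝ) where
  carrier := {h | ∃ (p : MvPolynomial (Fin d) ℂ) (c : ℝ) (u : C(CB d, ℝ)), 0 ≤ c ∧ (∀ z, 0 ≤ u z) ∧
    (∀ z ∈ K, c * M ≤ u z) ∧
    ∀ z ∈ sphereD d, u z - c * ε + (polyEval p z).re - (polyEval p 0).re ≤ h z}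
  zero_mem' := ⟨0, 0, 0, le_rfl, by simp, by simp, by simp [polyEval]⟩
  add_mem' := by
    rintro h h' ⟨p, c, u, hc, hu, huK, hz⟩ ⟨p', c', u', hc', hu', huK', hz'⟩
    refine ⟨p + p', c + c', u + u', add_nonneg hc hc', fun z => add_nonneg (hu z) (hu' z),
      fun z hK => ?_, fun z hS => ?_⟩
    · have := huK z hK; have := huK' z hK
      simp only [ContinuousMap.add_apply]; linarith
    · have := hz z hS; have := hz' z hS
      simp only [polyEval, map_add, Complex.add_re, ContinuousMap.add_apply] at *; linarith
  smul_mem' := by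
    rintro ⟨a, ha⟩ h ⟨p, c, u, hc, hu, huK, hz⟩
    refine ⟨MvPolynomial.C (a : ℂ) * p, a * c, a • u, mul_nonneg ha hc,
      fun z => mul_nonneg ha (hu z), fun z hK => ?_, fun z hS => ?_⟩
    · have := mul_le_mul_of_nonneg_left (huK z hK) ha
      simp only [ContinuousMap.smul_apply, smul_eq_mul]; linarith
    · have := mul_le_mul_of_nonneg_left (hz z hS) ha
      simp only [polyEval, map_mul, MvPolynomial.eval_C, Complex.re_ofReal_mul,
        ContinuousMap.smul_apply, smul_eq_mul] at *
      refine le_trans (le_of_eq ?_) this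
      ring

lemma exists_functional {d : ℕ} (hd : 1 ≤ d) {K : Set (CB d)} (hK : K ⊆ sphereD d) {M ε : ℝ}
    (H : ∀ p : MvPolynomial (Fin d) ℂ, (∀ z ∈ sphereD d, 0 ≤ (polyEval p z).re) →
      (∀ z ∈ K, M ≤ (polyEval p z).re) → ε ≤ (polyEval p 0).re) :
    ∃ g : C(CB d, ℝ) →ₗ[ℝ] ℝ, (∀ h : C(CB d, ℝ), (∀ z ∈ sphereD d, 0 ≤ h z) → 0 ≤ g h) ∧
      (∀ p, g (rePolyMap p) = (polyEval p 0).re) ∧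
      ∀ u : C(CB d, ℝ), (∀ z, 0 ≤ u z) → (∀ z ∈ K, M ≤ u z) → ε ≤ g u := by
  have H' : ∀ (q : MvPolynomial (Fin d) ℂ) (c : ℝ) , 0 ≤ c →
      (∀ z ∈ sphereD d, 0 ≤ (polyEval q z).re) → (∀ z ∈ K, c * M ≤ (polyEval q z).re) →
      c * ε ≤ (polyEval q 0).re := by
    intro q c hc h1 h2
    rcases hc.eq_or_lt with rfl | hc
    · rw [zero_mul]
      exact re_polyEval_nonneg hd (fun z hz => h1 ⟨z, by simp [hz]⟩ hz) (by simp)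
    · have e : ∀ z, (polyEval (MvPolynomial.C ((c⁻¹ : ℝ) : ℂ) * q) z).re =
          c⁻¹ * (polyEval q z).re := fun z => by
        simp only [polyEval, map_mul, MvPolynomial.eval_C, Complex.re_ofReal_mul]
      have := H (MvPolynomial.C ((c⁻¹ : ℝ) : ℂ) * q)
        (fun z hz => by rw [e]; exact mul_nonneg (inv_nonneg.mpr hc.le) (h1 z hz))
        (fun z hz => by rw [e, le_inv_mul_iff₀ hc]; exact h2 z hz)
      rwa [e, le_inv_mul_iff₀ hc] at this
  have hne : (1 : C(CB d, ℝ)) ≠ 0 := fun h => by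
    simpa using DFunLike.congr_fun h ⟨0, by simp⟩
  have heq : ∀ c : ℝ, c • (1 : C(CB d, ℝ)) = 0 → RingHom.id ℝ c • (1 : ℝ) = 0 := fun c hc => by
    simpa using (smul_eq_zero.mp hc).resolve_right hne
  obtain ⟨g, hg, hpos⟩ := riesz_extension (dominatingCone K M ε)
    (LinearPMap.mkSpanSingleton (1 : C(CB d, ℝ)) (1 : ℝ) hne) (by
      rintro ⟨x, hx⟩ hxs
      obtain ⟨a, rfl⟩ := Submodule.mem_span_singleton.mp hx
      obtain ⟨p, c, u, hc, hu, huK, hz⟩ := hxs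
      have e := LinearPMap.mkSpanSingleton'_apply (1 : C(CB d, ℝ)) (1 : ℝ)
        heq a hx
      refine le_of_le_of_eq ?_ e.symm
      have e2 : ∀ z, (polyEval (MvPolynomial.C ((a + c * ε : ℝ) + polyEval p 0) - p) z).re =
          a + c * ε + (polyEval p 0).re - (polyEval p z).re := fun z => by
        simp [polyEval]
      have h1 := H' (MvPolynomial.C ((a + c * ε : ℝ) + polyEval p 0) - p) c hc
        (fun z hS => by
          have := hz z hS; have := hu z
          simp only [ContinuousMap.smul_apply, ContinuousMap.one_apply, smul_eq_mul] at *
          rw [e2]; linarith)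
        (fun z hS => by
          have := hz z (hK hS); have := huK z hS
          simp only [ContinuousMap.smul_apply, ContinuousMap.one_apply, smul_eq_mul] at *
          rw [e2]; linarith)
      rw [e2] at h1
      simp only [smul_eq_mul, RingHom.id_apply]
      linarith)
    (fun y => ⟨⟨‖y‖ • 1, Submodule.smul_mem _ _ (Submodule.mem_span_singleton_self _)⟩, 0, 0, 0,
      le_rfl, by simp, by simp, fun z _ => by
        have := (abs_le.mp (y.norm_coe_le_norm z)).1
        simp only [polyEval, ContinuousMap.add_apply, ContinuousMap.smul_apply,
          ContinuousMap.one_apply, smul_eq_mul, map_zero, ContinuousMap.zero_apply, zero_mul,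
          Complex.zero_re]
        linarith⟩)
  have h1 : g 1 = 1 := by
    have e := LinearPMap.mkSpanSingleton'_apply (1 : C(CB d, ℝ)) (1 : ℝ)
      heq 1
      (Submodule.smul_mem _ _ (Submodule.mem_span_singleton_self _))
    have := hg ⟨(1 : ℝ) • 1, Submodule.smul_mem _ _ (Submodule.mem_span_singleton_self _)⟩
    simpa using this.trans e
  have hre : ∀ p, (polyEval p 0).re ≤ g (rePolyMap p) := fun p => by
    have := hpos (rePolyMap p - (polyEval p 0).re • 1) ⟨p, 0, 0, le_rfl, by simp, by simp,
      by simp⟩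
    rw [map_sub, map_smul, h1, smul_eq_mul] at this
    linarith
  refine ⟨g, fun h hh => hpos h ⟨0, 0, 0, le_rfl, by simp, by simp, fun z hz => by
    simpa [polyEval] using hh z hz⟩, fun p => (hre p).antisymm' ?_, fun u hu huK => ?_⟩
  · have e : rePolyMap (-p) = - rePolyMap p := by ext z; simp [polyEval]
    have := hre (-p)
    rw [e, map_neg] at this
    simp only [polyEval, map_neg, Complex.neg_re] at *
    linarith
  · have := hpos (u - ε • 1) ⟨0, 1, u, zero_le_one, hu, by simpa using huK, fun z _ => by
      simp [polyEval]⟩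
    rw [map_sub, map_smul, h1, smul_eq_mul] at this
    linarith

/-- A positive functional on the continuous functions on the sphere which evaluates real parts of
polynomials at the origin is integration against a Henkin measure. -/
lemma exists_henkin_integral_eq {d : ℕ} (g : C(CB d, ℝ) →ₗ[ℝ] ℝ)
    (hpos : ∀ h : C(CB d, ℝ), (∀ z ∈ sphereD d, 0 ≤ h z) → 0 ≤ g h)
    (hre : ∀ p, g (rePolyMap p) = (polyEval p 0).re) :
    ∃ μ : Measure (CB d), IsHenkin d μ ∧ ∀ h : C(CB d, ℝ), ∫ z, h z ∂μ = g h := by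
  let Λ : CompactlySupportedContinuousMap (CB d) ℝ →ₚ[ℝ] ℝ := PositiveLinearMap.mk₀
    { toFun := fun f => g f.toContinuousMap
      map_add' := fun f f' => g.map_add f.toContinuousMap f'.toContinuousMap
      map_smul' := fun c f => g.map_smul c f.toContinuousMap }
    fun f hf => hpos _ fun z _ => hf z
  set μ := RealRMK.rieszMeasure Λ
  have hint : ∀ h : C(CB d, ℝ), ∫ z, h z ∂μ = g h := fun h =>
    RealRMK.integral_rieszMeasure Λ ⟨h, HasCompactSupport.of_compactSpace h⟩
  have hintC : ∀ φ : C(CB d, ℂ), Integrable φ μ := fun φ =>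
    φ.continuous.integrable_of_hasCompactSupport (HasCompactSupport.of_compactSpace φ)
  have hsph : μ (sphereD d)ᶜ = 0 := by
    let h : C(CB d, ℝ) := ⟨fun z => 1 - ‖(z : EuclideanSpace ℂ (Fin d))‖, by fun_prop⟩
    have hh : ∀ z, 0 ≤ h z := fun z => sub_nonneg.mpr (mem_closedBall_zero_iff.mp z.2)
    have hS : ∀ z ∈ sphereD d, h z = 0 := fun z hz => sub_eq_zero.mpr (Eq.symm hz)
    have h0 : g h = 0 := by
      refine le_antisymm ?_ (hpos _ fun z _ => hh z)
      have := hpos (-h) fun z hz => by simp [hS z hz]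
      rw [map_neg] at this
      linarith
    have h1 := (integral_eq_zero_iff_of_nonneg (μ := μ) (f := h) hh
      (h.continuous.integrable_of_hasCompactSupport (HasCompactSupport.of_compactSpace h))).mp
      ((hint h).trans h0)
    refine measure_mono_null (fun z hz => ?_) (ae_iff.mp h1)
    exact fun hz0 => hz (sub_eq_zero.mp hz0).symm
  have hpoly : ∀ p : MvPolynomial (Fin d) ℂ, ∫ z, polyMap p z ∂μ = polyEval p 0 := by
    intro p
    have him : ∀ x, (polyEval p x).im = (polyEval (MvPolynomial.C (-Complex.I) * p) x).re :=
      fun x => by simp [polyEval]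
    apply Complex.ext
    · rw [← hre, ← hint]
      exact (integral_re (hintC (polyMap p))).symm
    · rw [him, ← hre, ← hint]
      refine (integral_im (hintC (polyMap p))).symm.trans (integral_congr_ae (.of_forall ?_))
      exact fun z => him z
  have hev : ∀ φ ∈ ballAlg d, ∫ z, φ z ∂μ = φ ⟨0, by simp⟩ := by
    intro φ hφ
    refine eq_of_forall_dist_le fun ε hε => ?_
    set m := μ.real univ
    have hm0 : 0 ≤ m := measureReal_nonneg
    obtain ⟨p, hp⟩ := exists_polyMap_norm_sub_lt hφ (ε := ε / (m + 1)) (by positivity)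
    have hp' : ∀ x, ‖φ x - polyMap p x‖ ≤ ε / (m + 1) := fun x =>
      ((φ - polyMap p).norm_coe_le_norm x).trans hp.le
    have h1 : ‖∫ z, (φ z - polyMap p z) ∂μ‖ ≤ ε / (m + 1) * m :=
      norm_integral_le_of_norm_le_const (.of_forall hp')
    rw [integral_sub (hintC φ) (hintC _), hpoly] at h1
    have h2 := hp' ⟨0, by simp⟩
    rw [dist_eq_norm]
    calc ‖∫ z, φ z ∂μ - φ ⟨0, by simp⟩‖
        = ‖(∫ z, φ z ∂μ - polyEval p 0) - (φ ⟨0, by simp⟩ - polyMap p ⟨0, by simp⟩)‖ := by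
          rw [polyMap_apply]; congr 1; ring
      _ ≤ ε / (m + 1) * m + ε / (m + 1) := (norm_sub_le _ _).trans (add_le_add h1 h2)
      _ = ε := by field_simp
  refine ⟨μ, ⟨inferInstance, inferInstance, hsph, fun f hf _ hlim => ?_⟩, hint⟩
  simp only [fun n => hev (f n) (hf n)]
  exact hlim _ (by simp [openD])

/-- The duality step: totally null compact sets carry large real parts of polynomials which are
nonnegative on the ball and small at the origin. -/
lemma exists_poly_re_ge {d : ℕ} (hd : 1 ≤ d) {K : Set (CB d)} (hKc : IsClosed K)
    (hTN : IsTotallyNull d K) {M ε : ℝ} (hM : 0 < M) (hε : 0 < ε) :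
    ∃ p : MvPolynomial (Fin d) ℂ, (∀ z : CB d, 0 ≤ (polyEval p z).re) ∧
      (∀ z ∈ K, M ≤ (polyEval p z).re) ∧ (polyEval p 0).re < ε := by
  by_contra! hcon
  obtain ⟨g, hpos, hre, hge⟩ := exists_functional hd hTN.1 (M := M) (ε := ε) fun p h1 h2 =>
    hcon p (fun z => re_polyEval_nonneg hd (fun x hx => h1 ⟨x, by simp [hx]⟩ hx)
      (mem_closedBall_zero_iff.mp z.2)) h2
  obtain ⟨μ, hμ, hint⟩ := exists_henkin_integral_eq g hpos hre
  have hfin := hμ.1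
  have hreg := hμ.2.1
  obtain ⟨U, hKU, hU, hμU⟩ := K.exists_isOpen_lt_of_lt (μ := μ) (ENNReal.ofReal (ε / M))
    (by rw [hTN.2 μ hμ]; exact ENNReal.ofReal_pos.mpr (div_pos hε hM))
  obtain ⟨v, hv0, hv1, hv⟩ := exists_continuous_zero_one_of_isClosed hU.isClosed_compl hKc
    (disjoint_compl_left_iff_subset.mpr hKU)
  have h1 := hge (M • v) (fun z => mul_nonneg hM.le (hv z).1) (fun z hz => by simp [hv1 hz])
  rw [← hint] at h1
  have h2 : ∫ z, (M • v) z ∂μ ≤ ∫ z, U.indicator (fun _ => M) z ∂μ := by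
    refine integral_mono ((M • v).continuous.integrable_of_hasCompactSupport
      (HasCompactSupport.of_compactSpace _))
      ((integrable_const M).indicator hU.measurableSet) fun z => ?_
    by_cases hz : z ∈ U
    · simpa [hz] using mul_le_of_le_one_right hM.le (hv z).2
    · simp [hz, hv0 hz]
  rw [integral_indicator_const _ hU.measurableSet, smul_eq_mul] at h2
  have h3 : μ.real U < ε / M := (ENNReal.lt_ofReal_iff_toReal_lt (measure_ne_top μ U)).mp hμU
  rw [lt_div_iff₀ hM] at h3
  linarith

/-- Elements of the ball algebra with real part bounded below are invertible in it. -/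
lemma exists_inv_mem_ballAlg {d : ℕ} {φ : C(CB d, ℂ)} (hφ : φ ∈ ballAlg d) {c : ℝ} (hc : 0 < c)
    (h : ∀ z, c ≤ (φ z).re) : ∃ ψ ∈ ballAlg d, ∀ z, φ z * ψ z = 1 := by
  have hcomplete : CompleteSpace (ballAlgSub d) := (isClosed_ballAlg d).completeSpace_coe
  set N := ‖φ‖ + c with hN
  have hNc : c ≤ N := by simp [hN]
  have hN0 : 0 < N := hc.trans_le hNc
  set t : ℝ := c / N ^ 2 with ht
  have ht0 : 0 < t := by positivity
  have hnorm : ‖(1 : C(CB d, ℂ)) - (t : ℂ) • φ‖ < 1 := by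
    rw [ContinuousMap.norm_lt_iff _ one_pos]
    intro z
    rw [← sq_lt_one_iff₀ (norm_nonneg _), ← Complex.normSq_eq_norm_sq, Complex.normSq_apply]
    have h1 : (φ z).re * (φ z).re + (φ z).im * (φ z).im ≤ N ^ 2 := by
      rw [← Complex.normSq_apply, Complex.normSq_eq_norm_sq]
      gcongr
      exact (φ.norm_coe_le_norm z).trans (by simp [hN, hc.le])
    have h2 : t * N ^ 2 = c := by rw [ht]; field_simp
    simp only [ContinuousMap.sub_apply, ContinuousMap.one_apply, ContinuousMap.smul_apply,
      smul_eq_mul, Complex.sub_re, Complex.sub_im, Complex.one_re, Complex.one_im,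
      Complex.re_ofReal_mul, Complex.im_ofReal_mul]
    have h3 : t ^ 2 * ((φ z).re * (φ z).re + (φ z).im * (φ z).im) ≤ t * c :=
      calc _ ≤ t ^ 2 * N ^ 2 := by gcongr
        _ = t * (t * N ^ 2) := by ring
        _ = t * c := by rw [h2]
    have h4 : t * c ≤ t * (φ z).re := by gcongr; exact h z
    have h5 : 0 < t * c := mul_pos ht0 hc
    nlinarith
  let x : ballAlgSub d := ⟨φ, hφ⟩
  have hx : IsUnit ((t : ℂ) • x) := by
    have := isUnit_one_sub_of_norm_lt_one (x := 1 - (t : ℂ) • x) hnorm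
    rwa [sub_sub_cancel] at this
  obtain ⟨y, hy⟩ := hx.exists_right_inv
  refine ⟨(t : ℂ) • (y : C(CB d, ℂ)), (ballAlgSub d).smul_mem y.2 _, fun z => ?_⟩
  have := DFunLike.congr_fun (congrArg Subtype.val hy) z
  refine Eq.trans ?_ this
  change φ z * ((t : ℂ) * (y : C(CB d, ℂ)) z) = ((t : ℂ) * φ z) * (y : C(CB d, ℂ)) z
  ring

lemma norm_polyEval_le_of_re_nonneg {d : ℕ} {p : MvPolynomial (Fin d) ℂ}
    (hp : ∀ z : CB d, 0 ≤ (polyEval p z).re) {ε : ℝ} (hε : 0 < ε) (h0 : ‖polyEval p 0‖ ≤ ε)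
    {z : EuclideanSpace ℂ (Fin d)} {r : ℝ} (hr : r < 1) (hz : ‖z‖ ≤ r) :
    ‖polyEval p z‖ ≤ 4 * ε / (1 - r) := by
  have hr0 : 0 ≤ r := (norm_nonneg z).trans hz
  set e : EuclideanSpace ℂ (Fin d) := ((‖z‖⁻¹ : ℝ) : ℂ) • z with he
  have hze : ((‖z‖ : ℝ) : ℂ) • e = z := by
    rcases eq_or_ne z 0 with rfl | hz0
    · simp
    · rw [he, smul_smul, ← Complex.ofReal_mul, mul_inv_cancel₀ (norm_ne_zero_iff.mpr hz0)]
      simp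
  have he1 : ‖e‖ ≤ 1 := by
    rw [he, norm_smul, Complex.norm_real, norm_inv, norm_norm]
    exact inv_mul_le_one
  have key := Complex.borelCaratheodory (f := fun s : ℂ => -polyEval p (s • e)) (M := ε) (R := 1)
    (z := ((‖z‖ : ℝ) : ℂ)) hε
    (((differentiable_polyEval p).comp (differentiable_id.smul_const e)).neg.differentiableOn)
    (fun s hs => by
      have : ‖s • e‖ ≤ 1 := by
        rw [norm_smul]
        exact mul_le_one₀ (mem_ball_zero_iff.mp hs).le (norm_nonneg _) he1
      have := hp ⟨s • e, mem_closedBall_zero_iff.mpr this⟩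
      simp only [mem_ofPred_eq, Complex.neg_re]
      linarith) one_pos (by simpa using hz.trans_lt hr)
  simp only [hze, norm_neg, zero_smul, Complex.norm_real, norm_norm] at key
  have hz1 : 0 < 1 - r := by linarith
  calc ‖polyEval p z‖ ≤ _ := key
    _ ≤ 2 * ε * 1 / (1 - r) + ε * (1 + 1) / (1 - r) := by gcongr <;> linarith
    _ = 4 * ε / (1 - r) := by ring

lemma exists_near_peak {d : ℕ} (hd : 1 ≤ d) {K : Set (CB d)} (hKc : IsClosed K)
    (hTN : IsTotallyNull d K) {ε : ℝ} (hε : 0 < ε) :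
    ∃ f ∈ ballAlg d, ‖f‖ ≤ 1 ∧ (∀ z ∈ K, ‖1 - f z‖ ≤ ε) ∧
      ∀ r < (1 : ℝ), ∀ z : CB d, ‖(z : EuclideanSpace ℂ (Fin d))‖ ≤ r →
        ‖f z‖ ≤ 4 * ε / (1 - r) := by
  obtain ⟨q, hq, hqK, hq0⟩ := exists_poly_re_ge hd hKc hTN (inv_pos.mpr hε) hε
  set p := q - MvPolynomial.C ((polyEval q 0).im * Complex.I) with hp
  have hpq : ∀ z, polyEval p z = polyEval q z - (polyEval q 0).im * Complex.I := fun z => by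
    simp [hp, polyEval]
  have hre : ∀ z, (polyEval p z).re = (polyEval q z).re := fun z => by simp [hpq]
  have hp0 : ‖polyEval p 0‖ ≤ ε := by
    have : polyEval p 0 = ((polyEval q 0).re : ℂ) := by
      rw [hpq]; apply Complex.ext <;> simp
    rw [this, Complex.norm_real, Real.norm_of_nonneg (hq ⟨0, by simp⟩)]
    exact hq0.le
  have hpre : ∀ z : CB d, 0 ≤ (polyEval p z).re := fun z => (hq z).trans_eq (hre z).symm
  obtain ⟨ψ, hψ, hinv⟩ := exists_inv_mem_ballAlg (φ := 1 + polyMap p)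
    ((ballAlgSub d).add_mem (ballAlgSub d).one_mem (polyMap_mem_ballAlg p)) one_pos fun z => by
      simpa using hpre z
  simp only [ContinuousMap.add_apply, ContinuousMap.one_apply, polyMap_apply] at hinv
  have hge : ∀ z : CB d, 1 + (polyEval p z).re ≤ ‖1 + polyEval p z‖ := fun z => by
    simpa using Complex.re_le_norm (1 + polyEval p z)
  have hpos : ∀ z : CB d, 0 < ‖1 + polyEval p z‖ := fun z => by linarith [hge z, hpre z]
  have hψn : ∀ z, ‖ψ z‖ = ‖1 + polyEval p z‖⁻¹ := fun z =>
    eq_inv_of_mul_eq_one_right (by rw [← norm_mul, hinv, norm_one])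
  refine ⟨polyMap p * ψ, (ballAlgSub d).mul_mem (polyMap_mem_ballAlg p) hψ,
    (ContinuousMap.norm_le _ zero_le_one).mpr fun z => ?_, fun z hz => ?_, fun r hr z hz => ?_⟩
  · rw [ContinuousMap.mul_apply, polyMap_apply, norm_mul, hψn, ← div_eq_mul_inv,
      div_le_one (hpos z), ← sq_le_sq₀ (norm_nonneg _) (norm_nonneg _),
      ← Complex.normSq_eq_norm_sq, ← Complex.normSq_eq_norm_sq, Complex.normSq_apply,
      Complex.normSq_apply]
    simp only [Complex.add_re, Complex.add_im, Complex.one_re, Complex.one_im]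
    nlinarith [hpre z]
  · have : 1 - polyEval p z * ψ z = ψ z := by rw [← hinv z]; ring
    rw [ContinuousMap.mul_apply, polyMap_apply, this, hψn]
    refine inv_le_of_inv_le₀ hε ?_
    have := hqK z hz
    rw [← hre] at this
    linarith [hge z]
  · rw [ContinuousMap.mul_apply, norm_mul, hψn, polyMap_apply]
    refine (mul_le_of_le_one_right (norm_nonneg _) (inv_le_one_of_one_le₀ ?_)).trans
      (norm_polyEval_le_of_re_nonneg hpre hε hp0 hr hz)
    linarith [hge z, hpre z]

lemma exists_vanishing_tendsto_one {d : ℕ} (hd : 1 ≤ d) {K : Set (CB d)} (hKc : IsClosed K)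
    (hTN : IsTotallyNull d K) : ∃ f : ℕ → C(CB d, ℂ), Vanishing f ∧ (∀ n, ‖f n‖ ≤ 1) ∧
      ∀ ε > 0, ∀ᶠ n in atTop, ∀ z ∈ K, ‖1 - f n z‖ ≤ ε := by
  choose f hf hf1 hfK hfr using fun n : ℕ =>
    exists_near_peak hd hKc hTN (Nat.one_div_pos_of_nat (α := ℝ) (n := n))
  have h0 := tendsto_one_div_add_atTop_nhds_zero_nat (𝕜 := ℝ)
  refine ⟨f, ⟨hf, ⟨1, hf1⟩, fun r hr ε hε => ?_⟩, hf1, fun ε hε => ?_⟩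
  · have hr' : 0 < 1 - r := by linarith
    filter_upwards [h0.eventually_le_const (show 0 < ε * (1 - r) / 4 by positivity)] with n hn z hz
    refine (hfr n r hr z hz).trans ?_
    rw [div_le_iff₀ hr']
    linarith
  · filter_upwards [h0.eventually_le_const hε] with n hn z hz
    exact (hfK n z hz).trans hn

/-- Approximate interpolation on a totally null compact set, with small values at a point. -/
lemma exists_approx_interpolation {d : ℕ} (hd : 1 ≤ d) {K : Set (CB d)} (hKc : IsClosed K)
    (hTN : IsTotallyNull d K) {lam : CB d} (hlam : lam ∈ openD d) (h : C(CB d, ℂ)) {ε : ℝ}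
    (hε : 0 < ε) : ∃ G ∈ ballAlg d, ‖G‖ ≤ ‖h‖ + ε ∧ (∀ z ∈ K, ‖G z - h z‖ ≤ ε) ∧ ‖G lam‖ ≤ ε := by
  obtain ⟨f, hf, hf1, hfK⟩ := exists_vanishing_tendsto_one hd hKc hTN
  obtain ⟨q, hq, hqh⟩ := exists_isVanishingMultiplier_norm_sub_lt hd h (half_pos hε)
  have hqh' : ∀ z, ‖h z - q z‖ ≤ ε / 2 := fun z => ((h - q).norm_coe_le_norm z).trans hqh.le
  obtain ⟨g, hg, hqg⟩ := hq f hf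
  have hN : 0 < ‖h‖ + 1 := by positivity
  obtain ⟨n, hn1, hn2, hn3⟩ := ((hqg _ (show 0 < ε / 4 by positivity)).and
    ((hfK (ε / 4 / (‖h‖ + 1)) (by positivity)).and (hg.2.2 _ hlam ε hε))).exists
  have hclose : ∀ z ∈ sphereD d, ‖h z * f n z - g n z‖ ≤ ε / 2 + ε / 4 := fun z hz => by
    have h1 : ‖(h z - q z) * f n z‖ ≤ ε / 2 * 1 := by
      rw [norm_mul]
      gcongr
      · exact hqh' z
      · exact ((f n).norm_coe_le_norm z).trans (hf1 n)
    calc ‖h z * f n z - g n z‖ = ‖(h z - q z) * f n z + (q z * f n z - g n z)‖ := by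
          congr 1; ring
      _ ≤ _ := norm_add_le _ _
      _ ≤ _ := by linarith [hn1 z hz]
  refine ⟨g n, hg.1 n, norm_le_of_mem_ballAlg hd (hg.1 n) fun z hz => ?_, fun z hz => ?_,
    hn3 lam le_rfl⟩
  · have h1 : ‖h z * f n z‖ ≤ ‖h‖ * 1 := by
      rw [norm_mul]
      gcongr
      · exact h.norm_coe_le_norm z
      · exact ((f n).norm_coe_le_norm z).trans (hf1 n)
    have h2 := norm_sub_norm_le (g n z) (h z * f n z)
    rw [norm_sub_rev] at h2
    linarith [hclose z hz]
  · have h1 : ‖h z * (1 - f n z)‖ ≤ (‖h‖ + 1) * (ε / 4 / (‖h‖ + 1)) := by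
      rw [norm_mul]
      gcongr
      · exact (h.norm_coe_le_norm z).trans (by simp)
      · exact hn2 z hz
    rw [mul_div_cancel₀ _ hN.ne'] at h1
    calc ‖g n z - h z‖ = ‖h z * (1 - f n z) + (h z * f n z - g n z)‖ := by
          rw [norm_sub_rev]; congr 1; ring
      _ ≤ _ := norm_add_le _ _
      _ ≤ ε := by linarith [hclose z (hTN.1 hz)]

/-- A continuous linear map with controlled approximate preimages has controlled preimages. -/
lemma exists_preimage_norm_le_of_approx {E F : Type*} [NormedAddCommGroup E] [NormedSpace ℂ E]
    [CompleteSpace E] [NormedAddCommGroup F] [NormedSpace ℂ F] (T : E →L[ℂ] F) {C : ℝ}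
    (hC : 0 ≤ C) (hT : ∀ y, ∃ x, ‖T x - y‖ ≤ 1 / 2 * ‖y‖ ∧ ‖x‖ ≤ C * ‖y‖) (y : F) :
    ∃ x, T x = y ∧ ‖x‖ ≤ 2 * C * ‖y‖ := by
  choose g hg using hT
  let h : F → F := fun y => y - T (g y)
  have hle : ∀ y, ‖h y‖ ≤ 1 / 2 * ‖y‖ := fun y => by
    rw [norm_sub_rev]
    exact (hg y).1
  have hnle : ∀ n : ℕ, ‖h^[n] y‖ ≤ (1 / 2) ^ n * ‖y‖ := by
    intro n
    induction n with
    | zero => simp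
    | succ n ih =>
      rw [Function.iterate_succ_apply', pow_succ', mul_assoc]
      exact (hle _).trans (by gcongr)
  let u : ℕ → E := fun n => g (h^[n] y)
  have ule : ∀ n, ‖u n‖ ≤ (1 / 2) ^ n * (C * ‖y‖) := fun n => by
    refine (hg _).2.trans ?_
    calc C * ‖h^[n] y‖ ≤ C * ((1 / 2) ^ n * ‖y‖) := by gcongr; exact hnle n
      _ = (1 / 2) ^ n * (C * ‖y‖) := by ring
  have hgeom : Summable fun n : ℕ => (1 / 2 : ℝ) ^ n * (C * ‖y‖) :=
    summable_geometric_two.mul_right _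
  have hsum : Summable fun n => ‖u n‖ := .of_nonneg_of_le (fun n => norm_nonneg _) ule hgeom
  refine ⟨∑' n, u n, ?_, ?_⟩
  · have hpart : ∀ n : ℕ, T (∑ i ∈ Finset.range n, u i) = y - h^[n] y := by
      intro n
      induction n with
      | zero => simp
      | succ n ih => rw [Finset.sum_range_succ, map_add, ih, Function.iterate_succ_apply', sub_add]
    have h1 := (T.continuous.tendsto _).comp hsum.of_norm.hasSum.tendsto_sum_nat
    simp only [Function.comp_def, hpart] at h1
    have h0 : Tendsto (fun n => h^[n] y) atTop (𝓝 0) := by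
      refine squeeze_zero_norm hnle ?_
      rw [← zero_mul ‖y‖]
      exact (tendsto_pow_atTop_nhds_zero_of_lt_one (by norm_num) (by norm_num)).mul_const _
    have h2 : Tendsto (fun n => y - h^[n] y) atTop (𝓝 (y - 0)) := tendsto_const_nhds.sub h0
    rw [sub_zero] at h2
    exact tendsto_nhds_unique h1 h2
  · calc ‖∑' n, u n‖ ≤ ∑' n, ‖u n‖ := norm_tsum_le_tsum_norm hsum
      _ ≤ ∑' n, (1 / 2 : ℝ) ^ n * (C * ‖y‖) := hsum.tsum_le_tsum ule hgeom
      _ = 2 * C * ‖y‖ := by rw [tsum_mul_right, tsum_geometric_two, mul_assoc]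

/-- The functions in the ball algebra which vanish at `lam`. -/
def vanishingAt {d : ℕ} (lam : CB d) : Submodule ℂ C(CB d, ℂ) where
  carrier := {φ | φ ∈ ballAlg d ∧ φ lam = 0}
  zero_mem' := ⟨(ballAlgSub d).zero_mem, rfl⟩
  add_mem' hf hg := ⟨(ballAlgSub d).add_mem hf.1 hg.1, by simp [hf.2, hg.2]⟩
  smul_mem' c f hf := ⟨(ballAlgSub d).smul_mem hf.1 c, by simp [hf.2]⟩

lemma isClosed_vanishingAt {d : ℕ} (lam : CB d) :
    IsClosed (vanishingAt lam : Set C(CB d, ℂ)) :=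
  (isClosed_ballAlg d).inter (isClosed_eq (continuous_eval_const lam)
    continuous_const)

lemma exists_approx_vanishingAt {d : ℕ} (hd : 1 ≤ d) {K : Set (CB d)} (hKc : IsClosed K)
    (hTN : IsTotallyNull d K) {lam : CB d} (hlam : lam ∈ openD d) [CompactSpace K] (f : C(K, ℂ))
    {ε : ℝ} (hε : 0 < ε) :
    ∃ G ∈ vanishingAt lam, ‖G‖ ≤ ‖f‖ + ε ∧ ∀ z : K, ‖G z - f z‖ ≤ ε := by
  obtain ⟨h, hh, hres⟩ := BoundedContinuousFunction.exists_norm_eq_domRestrict_eq hKc ℂ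
    (BoundedContinuousFunction.mkOfCompact f)
  rw [BoundedContinuousFunction.norm_mkOfCompact] at hh
  obtain ⟨G, hG, hGn, hGK, hGl⟩ := exists_approx_interpolation hd hKc hTN hlam h.toContinuousMap
    (half_pos hε)
  have hn : ‖h.toContinuousMap‖ = ‖f‖ := hh
  have hc : ‖ContinuousMap.const (CB d) (G lam)‖ ≤ ε / 2 :=
    (ContinuousMap.norm_le _ (half_pos hε).le).mpr fun _ => hGl
  refine ⟨G - ContinuousMap.const _ (G lam), ⟨(ballAlgSub d).sub_mem hG
    ((ballAlgSub d).algebraMap_mem (G lam)), by simp⟩, ?_, fun z => ?_⟩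
  · refine (norm_sub_le _ _).trans ?_
    linarith
  · have e : f z = h z := (DFunLike.congr_fun hres z).symm
    calc ‖G z - G lam - f z‖ = ‖(G z - h z) - G lam‖ := by rw [e]; congr 1; ring
      _ ≤ _ := norm_sub_le _ _
      _ ≤ ε / 2 + ε / 2 := add_le_add (hGK z z.2) hGl
      _ = ε := by ring

/-- Interpolation on a totally null compact set by functions in the open unit ball of the ball
algebra which vanish at a given point. -/
lemma exists_interpolation_vanishingAt {d : ℕ} (hd : 1 ≤ d) {K : Set (CB d)} (hKc : IsClosed K)
    (hTN : IsTotallyNull d K) {lam : CB d} (hlam : lam ∈ openD d) (f : C(K, ℂ)) {s : ℝ}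
    (hs0 : 0 ≤ s) (hs : s < 1) (hf : ∀ z, ‖f z‖ ≤ s) :
    ∃ G ∈ ballAlg d, ‖G‖ < 1 ∧ G lam = 0 ∧ ∀ z : K, G z = f z := by
  have hcK : CompactSpace K := isCompact_iff_compactSpace.mp hKc.isCompact
  have hcomplete : CompleteSpace (vanishingAt lam) := (isClosed_vanishingAt lam).completeSpace_coe
  let T : vanishingAt lam →L[ℂ] C(K, ℂ) :=
    (ContinuousMap.compCLM ℂ ℂ (⟨Subtype.val, continuous_subtype_val⟩ : C(K, CB d))).comp
      (vanishingAt lam).subtypeL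
  have hT : ∀ x z, T x z = (x : C(CB d, ℂ)) z := fun x z => rfl
  have hT2 : ∀ y, ∃ x, ‖T x - y‖ ≤ 1 / 2 * ‖y‖ ∧ ‖x‖ ≤ 2 * ‖y‖ := by
    intro y
    rcases eq_or_ne y 0 with rfl | hy
    · exact ⟨0, by simp, by simp⟩
    · have hy0 : 0 < ‖y‖ := norm_pos_iff.mpr hy
      obtain ⟨G, hG, hGn, hGK⟩ := exists_approx_vanishingAt hd hKc hTN hlam y (half_pos hy0)
      refine ⟨⟨G, hG⟩, (ContinuousMap.norm_le _ (by positivity)).mpr fun z => ?_, ?_⟩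
      · exact (hGK z).trans (by linarith)
      · exact hGn.trans (by linarith)
  obtain ⟨G, hG, hGn, hGK⟩ := exists_approx_vanishingAt hd hKc hTN hlam f
    (show 0 < (1 - s) / 6 by linarith)
  obtain ⟨x, hx, hxn⟩ := exists_preimage_norm_le_of_approx T zero_le_two hT2 (f - T ⟨G, hG⟩)
  have hfn : ‖f‖ ≤ s := (ContinuousMap.norm_le _ hs0).mpr hf
  have hdiff : ‖f - T ⟨G, hG⟩‖ ≤ (1 - s) / 6 :=
    (ContinuousMap.norm_le _ (by linarith)).mpr fun z => by
      rw [ContinuousMap.sub_apply, norm_sub_rev]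
      exact hGK z
  have hmem := (vanishingAt lam).add_mem hG x.2
  refine ⟨G + x, hmem.1, ?_, hmem.2, fun z => ?_⟩
  · have hxn' : ‖(x : C(CB d, ℂ))‖ ≤ 2 * 2 * ‖f - T ⟨G, hG⟩‖ := hxn
    refine (norm_add_le _ _).trans_lt ?_
    linarith
  · have := DFunLike.congr_fun hx z
    rw [hT, ContinuousMap.sub_apply, hT] at this
    rw [ContinuousMap.add_apply, this, add_sub_cancel]

lemma norm_sub_lt_norm_one_sub_conj_mul {a b : ℂ} (ha : ‖a‖ < 1) (hb : ‖b‖ < 1) :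
    ‖b - a‖ < ‖1 - (starRingEnd ℂ) a * b‖ := by
  rw [← sq_lt_sq₀ (norm_nonneg _) (norm_nonneg _), ← sub_pos]
  have h : ‖1 - (starRingEnd ℂ) a * b‖ ^ 2 - ‖b - a‖ ^ 2 = (1 - ‖a‖ ^ 2) * (1 - ‖b‖ ^ 2) := by
    simp only [← Complex.normSq_eq_norm_sq, Complex.normSq_apply, Complex.sub_re, Complex.sub_im,
      Complex.mul_re, Complex.mul_im, Complex.conj_re, Complex.conj_im, Complex.one_re,
      Complex.one_im]
    ring
  rw [h]
  exact mul_pos (sub_pos.mpr (pow_lt_one₀ (norm_nonneg _) ha two_ne_zero))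
    (sub_pos.mpr (pow_lt_one₀ (norm_nonneg _) hb two_ne_zero))

/-- Post-composition of a function in the open unit ball of the ball algebra with a Möbius
transformation of the disc. -/
lemma exists_mobius_mem_ballAlg {d : ℕ} {G : C(CB d, ℂ)} (hG : G ∈ ballAlg d) (hG1 : ‖G‖ < 1)
    {a : ℂ} (ha : ‖a‖ < 1) :
    ∃ φ ∈ ballAlg d, ‖φ‖ < 1 ∧
      ∀ z w, G z + a = w * (1 + (starRingEnd ℂ) a * G z) → φ z = w := by
  have hGz : ∀ z, ‖G z‖ < 1 := fun z => (G.norm_coe_le_norm z).trans_lt hG1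
  obtain ⟨ψ, hψ, hinv⟩ := exists_inv_mem_ballAlg (φ := 1 + (starRingEnd ℂ) a • G)
    ((ballAlgSub d).add_mem (ballAlgSub d).one_mem ((ballAlgSub d).smul_mem hG _))
    (sub_pos.mpr ha) fun z => by
      have h1 := (abs_le.mp (Complex.abs_re_le_norm ((starRingEnd ℂ) a * G z))).1
      have h2 : ‖(starRingEnd ℂ) a * G z‖ ≤ ‖a‖ := by
        rw [norm_mul, RCLike.norm_conj]
        exact mul_le_of_le_one_right (norm_nonneg _) (hGz z).le
      simp only [ContinuousMap.add_apply, ContinuousMap.one_apply, ContinuousMap.smul_apply,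
        smul_eq_mul, Complex.add_re, Complex.one_re]
      linarith
  simp only [ContinuousMap.add_apply, ContinuousMap.one_apply, ContinuousMap.smul_apply,
    smul_eq_mul] at hinv
  refine ⟨(G + ContinuousMap.const _ a) * ψ, (ballAlgSub d).mul_mem ((ballAlgSub d).add_mem hG
    ((ballAlgSub d).algebraMap_mem a)) hψ, (ContinuousMap.norm_lt_iff _ one_pos).mpr fun z => ?_,
    fun z w h => ?_⟩
  · have h := norm_sub_lt_norm_one_sub_conj_mul (a := -a) (by rwa [norm_neg]) (hGz z)
    rw [map_neg, neg_mul, sub_neg_eq_add, sub_neg_eq_add] at h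
    have hψ0 : 0 < ‖ψ z‖ := norm_pos_iff.mpr fun h0 => by simpa [h0] using hinv z
    calc ‖(G z + a) * ψ z‖ = ‖G z + a‖ * ‖ψ z‖ := norm_mul _ _
      _ < ‖1 + (starRingEnd ℂ) a * G z‖ * ‖ψ z‖ := by gcongr
      _ = 1 := by rw [← norm_mul, hinv, norm_one]
  · change (G z + a) * ψ z = w
    rw [h, mul_assoc, hinv, mul_one]

/-- the restriction of the open unit ball of the ball algebra to
`K ∪ {λ}` is the open unit ball of `C(K ∪ {λ})`. -/
theorem stmt10 (d : ℕ) (hd : 1 ≤ d) (K : Set (CB d)) (hKc : IsClosed K)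
    (hTN : IsTotallyNull d K) (lam : CB d) (hlam : lam ∈ openD d) :
    ∀ f : ↥(K ∪ {lam}) → ℂ, Continuous f → (⨆ z : ↥(K ∪ {lam}), ‖f z‖) < 1 →
      ∃ φ ∈ ballAlg d, ‖φ‖ < 1 ∧ ∀ z : ↥(K ∪ {lam}), φ z.1 = f z := by
  intro f hf hsup
  have hcY : CompactSpace ↥(K ∪ {lam}) :=
    isCompact_iff_compactSpace.mp (hKc.isCompact.union isCompact_singleton)
  have hfz : ∀ z, ‖f z‖ < 1 := fun z =>
    (le_ciSup (isCompact_range hf.norm).bddAbove z).trans_lt hsup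
  have hcK : CompactSpace K := isCompact_iff_compactSpace.mp hKc.isCompact
  set a := f ⟨lam, Or.inr rfl⟩ with ha
  have hlt : ∀ z, ‖f z - a‖ < ‖1 - (starRingEnd ℂ) a * f z‖ := fun z =>
    norm_sub_lt_norm_one_sub_conj_mul (hfz _) (hfz z)
  have hne : ∀ z, 1 - (starRingEnd ℂ) a * f z ≠ 0 := fun z =>
    norm_pos_iff.mp ((norm_nonneg _).trans_lt (hlt z))
  let j : K → ↥(K ∪ {lam}) := fun z => ⟨z, Or.inl z.2⟩
  have hj : Continuous fun z => f (j z) := hf.comp (continuous_subtype_val.subtype_mk _)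
  let F : C(K, ℂ) := ⟨fun z => (f (j z) - a) / (1 - (starRingEnd ℂ) a * f (j z)),
    (hj.sub continuous_const).div (continuous_const.sub (continuous_const.mul hj))
      fun z => hne (j z)⟩
  have hF1 : ‖F‖ < 1 := (ContinuousMap.norm_lt_iff _ one_pos).mpr fun z => by
    change ‖(f (j z) - a) / (1 - (starRingEnd ℂ) a * f (j z))‖ < 1
    rw [norm_div, div_lt_one (norm_pos_iff.mpr (hne _))]
    exact hlt _
  obtain ⟨G, hG, hG1, hGl, hGK⟩ := exists_interpolation_vanishingAt hd hKc hTN hlam F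
    (norm_nonneg F) hF1 F.norm_coe_le_norm
  obtain ⟨φ, hφ, hφ1, hφw⟩ := exists_mobius_mem_ballAlg hG hG1 (hfz ⟨lam, Or.inr rfl⟩)
  refine ⟨φ, hφ, hφ1, ?_⟩
  rintro ⟨z, hz⟩
  refine hφw z _ ?_
  by_cases hzK : z ∈ K
  · have h1 : G z = (f ⟨z, hz⟩ - a) / (1 - (starRingEnd ℂ) a * f ⟨z, hz⟩) := hGK ⟨z, hzK⟩
    rw [eq_div_iff (hne _)] at h1
    linear_combination h1
  · obtain rfl : z = lam := hz.resolve_left hzK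
    rw [hGl]
    simp

end
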